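/- arXiv:2109.11761 — 2 statements merged into one kernel-verified Lean document; each statement's English description precedes it below -/
import Mathlib

section
/- Let f be a Lebesgue density on [0,1] and F(x) = ∫₀^x f(z) dz. If F is not convex on [0,1], i.e. there exist 0 ≤ x₁ < x₂ < x₃ ≤ 1 with (F(x₂) − F(x₁))/(x₂ − x₁) > (F(x₃) − F(x₂))/(x₃ − x₂), then there exists a Borel probability measure G on [0,1] that is stochastically smaller than UNIF(0,1) and satisfies ∫ f dG > 1. -/
open MeasureTheory Set intervalIntegral
open scoped ENNReal

/-- If `f` is a Lebesgue density on `[0,1]` whose primitive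
`F(x) = ∫₀ˣ f(z) dz` is not convex, as witnessed by points `x₁ < x₂ < x₃` with a larger
slope on `[x₁,x₂]` than on `[x₂,x₃]`, then there is a Borel probability measure `G` on
`[0,1]` that is stochastically smaller than `UNIF(0,1)` with `∫ f dG > 1`. -/
theorem stmt11
    (f : ℝ → ℝ) (hf_meas : Measurable f)
    (hf_nonneg : ∀ x ∈ Set.Icc (0:ℝ) 1, 0 ≤ f x)
    (hf_dens : ∫ x in Set.Icc (0:ℝ) 1, f x ∂volume = 1)
    (x₁ x₂ x₃ : ℝ) (h0 : 0 ≤ x₁) (h12 : x₁ < x₂) (h23 : x₂ < x₃) (h31 : x₃ ≤ 1)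
    (hslope : ((∫ z in (0:ℝ)..x₃, f z) - ∫ z in (0:ℝ)..x₂, f z) / (x₃ - x₂) <
      ((∫ z in (0:ℝ)..x₂, f z) - ∫ z in (0:ℝ)..x₁, f z) / (x₂ - x₁)) :
    ∃ G : Measure ℝ, IsProbabilityMeasure G ∧ G ((Set.Icc (0:ℝ) 1)ᶜ) = 0 ∧
      (∀ x ∈ Set.Icc (0:ℝ) 1, ENNReal.ofReal x ≤ G (Set.Iic x)) ∧
      1 < ∫ x, f x ∂G := by
  have hx : 0 < x₂ - x₁ := sub_pos.2 h12
  have hfi : IntegrableOn f (Icc (0:ℝ) 1) := by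
    by_contra h
    rw [integral_undef h] at hf_dens
    exact zero_ne_one hf_dens
  have hsub : ∀ {a b : ℝ}, 0 ≤ a → b ≤ 1 → IntegrableOn f (Ioc a b) := fun ha hb =>
    hfi.mono_set (Ioc_subset_Icc_self.trans (Icc_subset_Icc ha hb))
  have hii : ∀ {a b : ℝ}, 0 ≤ a → a ≤ b → b ≤ 1 → IntervalIntegrable f volume a b :=
    fun ha hab hb => (intervalIntegrable_iff_integrableOn_Ioc_of_le hab).2 (hsub ha hb)
  obtain ⟨c, hc⟩ : ∃ c, c = (x₃ - x₁) / (x₂ - x₁) := ⟨_, rfl⟩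
  have hcx : c * (x₂ - x₁) = x₃ - x₁ := by rw [hc]; field_simp
  have hc1 : 1 ≤ c := by rw [hc, one_le_div hx]; linarith
  have hc0 : 0 ≤ c := zero_le_one.trans hc1
  -- Move the mass of `(x₂, x₃]` uniformly onto `(x₁, x₂]`.
  obtain ⟨G, hG⟩ : ∃ G : Measure ℝ, G = volume.restrict (Ioc 0 x₁) +
    ENNReal.ofReal c • volume.restrict (Ioc x₁ x₂) + volume.restrict (Ioc x₃ 1) := ⟨_, rfl⟩
  have hGs : ∀ s, MeasurableSet s → G s = volume (s ∩ Ioc 0 x₁) +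
      ENNReal.ofReal c * volume (s ∩ Ioc x₁ x₂) + volume (s ∩ Ioc x₃ 1) := by
    intro s hs
    simp [hG, Measure.restrict_apply hs]
  refine ⟨G, ⟨?_⟩, ?_, ?_, ?_⟩
  · rw [hGs _ MeasurableSet.univ]
    simp only [univ_inter, Real.volume_Ioc]
    rw [← ENNReal.ofReal_mul hc0, ← ENNReal.ofReal_add (by linarith) (by positivity),
      ← ENNReal.ofReal_add (by rw [hcx]; linarith) (by linarith), hcx, ENNReal.ofReal_eq_one]
    ring
  · have hempty : ∀ {a b : ℝ}, 0 ≤ a → b ≤ 1 → (Icc (0:ℝ) 1)ᶜ ∩ Ioc a b = ∅ := fun ha hb =>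
      disjoint_iff_inter_eq_empty.1 (disjoint_compl_left_iff_subset.2
        (Ioc_subset_Icc_self.trans (Icc_subset_Icc ha hb)))
    rw [hGs _ measurableSet_Icc.compl, hempty le_rfl (by linarith), hempty h0 (by linarith),
      hempty (by linarith) le_rfl]
    simp
  · rintro x ⟨hx0, hx1⟩
    rw [hGs _ measurableSet_Iic]
    simp only [inter_comm (Iic x), Ioc_inter_Iic, Real.volume_Ioc]
    rcases le_total x x₁ with h | h
    · rw [min_eq_right h, sub_zero, add_assoc]
      exact le_self_add
    rw [min_eq_left h, sub_zero]
    rcases le_total x x₂ with h' | h'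
    · rw [min_eq_right h', ← ENNReal.ofReal_mul hc0,
        ← ENNReal.ofReal_add h0 (mul_nonneg hc0 (by linarith))]
      refine le_trans (ENNReal.ofReal_le_ofReal ?_) le_self_add
      nlinarith
    rw [min_eq_left h', ← ENNReal.ofReal_mul hc0, hcx,
      ← ENNReal.ofReal_add h0 (by linarith), min_eq_right hx1]
    refine le_trans (ENNReal.ofReal_le_ofReal ?_) ENNReal.ofReal_add_le
    linarith
  · have i1 : Integrable f (volume.restrict (Ioc 0 x₁)) := hsub le_rfl (by linarith)
    have i2 : Integrable f (ENNReal.ofReal c • volume.restrict (Ioc x₁ x₂)) :=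
      Integrable.smul_measure (hsub h0 (by linarith)) ENNReal.ofReal_ne_top
    have i3 : Integrable f (volume.restrict (Ioc x₃ 1)) := hsub (by linarith) le_rfl
    rw [hG, integral_add_measure (i1.add_measure i2) i3, integral_add_measure i1 i2,
      MeasureTheory.integral_smul_measure, ENNReal.toReal_ofReal hc0, smul_eq_mul,
      ← integral_of_le h0, ← integral_of_le h12.le, ← integral_of_le h31]
    rw [integral_Icc_eq_integral_Ioc, ← integral_of_le zero_le_one] at hf_dens
    have a1 := integral_add_adjacent_intervals (hii le_rfl h0 (by linarith))
      (hii h0 h12.le (by linarith))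
    have a2 := integral_add_adjacent_intervals (hii le_rfl (by linarith) (by linarith))
      (hii (h0.trans h12.le) h23.le h31)
    have a3 := integral_add_adjacent_intervals (hii le_rfl (by linarith) h31)
      (hii (by linarith) h31 le_rfl)
    rw [← a2, ← a1, add_sub_cancel_left, add_sub_cancel_left,
      div_lt_div_iff₀ (sub_pos.2 h23) hx] at hslope
    have key : ∫ z in x₂..x₃, f z < (c - 1) * ∫ z in x₁..x₂, f z := by
      have hc' : c - 1 = (x₃ - x₂) / (x₂ - x₁) := by rw [hc]; field_simp; ring
      rw [hc', div_mul_eq_mul_div, lt_div_iff₀ hx]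
      linarith
    linarith
end

section
/- Let Z be standard normally distributed, let η be independent of Z with P(η = 1) = P(η = −1) = 1/2, and let Φ denote the standard normal CDF. Then the random variable U = (1/2)(Φ(Z) + Φ(Z − η)) is uniformly distributed on (0,1). Consequently, the unfocused forecast F(y) = (1/2)(Φ(y − μ) + Φ(y − μ − η)) for an observation Y = μ + Z is probabilistically calibrated. -/
open MeasureTheory ProbabilityTheory Set
open scoped ENNReal

/-- The standard normal cumulative distribution function `Φ`. -/
noncomputable def stdNormalCDF : ℝ → ℝ := fun z => ProbabilityTheory.cdf (gaussianReal 0 1) z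

/-- The cumulative distribution function of an atomless probability measure is continuous. -/
theorem continuous_cdf_of_nullSingletonClass (m : Measure ℝ) [IsProbabilityMeasure m]
    [NullSingletonClass m] : Continuous (cdf m) := by
  refine continuous_iff_continuousAt.2 fun x => ?_
  have hleft : Function.leftLim (cdf m) x = cdf m x := by
    have h := (cdf m).measure_singleton x
    rw [measure_cdf, measure_singleton] at h
    exact le_antisymm ((monotone_cdf m).leftLim_le le_rfl)
      (by linarith [ENNReal.ofReal_eq_zero.1 h.symm])
  rw [(monotone_cdf m).continuousAt_iff_leftLim_eq_rightLim, hleft, (cdf m).rightLim_eq]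

/-- The uniform distribution on `(0, 1)` gives mass `u` to the half-line `(-∞, u]` for `u ≤ 1`. -/
theorem volume_restrict_Ioo_zero_one_Iic {u : ℝ} (hu : u ≤ 1) :
    volume.restrict (Ioo (0 : ℝ) 1) (Iic u) = ENNReal.ofReal u := by
  rw [Measure.restrict_congr_set Ioo_ae_eq_Ioc, Measure.restrict_apply measurableSet_Iic,
    Iic_inter_Ioc_of_le hu, Real.volume_Ioc, sub_zero]

/-- The **probability integral transform**: if `m` is an atomless probability measure on `ℝ`, then
its cumulative distribution function pushes `m` forward to the uniform distribution on `(0, 1)`. -/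
theorem map_cdf_eq_uniform (m : Measure ℝ) [IsProbabilityMeasure m] [NullSingletonClass m] :
    Measure.map (cdf m) m = volume.restrict (Ioo (0 : ℝ) 1) := by
  have hcont := continuous_cdf_of_nullSingletonClass m
  have : IsProbabilityMeasure (Measure.map (cdf m) m) :=
    Measure.isProbabilityMeasure_map hcont.measurable.aemeasurable
  refine Measure.ext_of_Iic _ _ fun u => ?_
  rw [Measure.map_apply hcont.measurable measurableSet_Iic]
  rcases le_or_gt 1 u with hu | hu
  · have hpre : cdf m ⁻¹' Iic u = univ := eq_univ_of_forall fun x => (cdf_le_one m x).trans hu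
    rw [hpre, measure_univ, Measure.restrict_apply measurableSet_Iic,
      inter_eq_right.2 fun x hx => hx.2.le.trans hu]
    simp
  rw [volume_restrict_Ioo_zero_one_Iic hu.le]
  obtain ⟨b, hb⟩ := ((tendsto_cdf_atTop m).eventually_const_lt hu).exists
  rcases (cdf m ⁻¹' Iic u).eq_empty_or_nonempty with hS | hS
  · have hu0 : u ≤ 0 := by
      by_contra! h
      obtain ⟨a, ha⟩ := ((tendsto_cdf_atBot m).eventually_lt_const h).exists
      exact (hS ▸ (show a ∈ cdf m ⁻¹' Iic u from ha.le) : a ∈ (∅ : Set ℝ))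
    rw [hS, measure_empty, ENNReal.ofReal_of_nonpos hu0]
  · have hbdd : BddAbove (cdf m ⁻¹' Iic u) :=
      ⟨b, fun x hx => ((monotone_cdf m).reflect_lt (lt_of_le_of_lt hx hb)).le⟩
    have hmem := (isClosed_Iic.preimage hcont).csSup_mem hS hbdd
    set x₀ := sSup (cdf m ⁻¹' Iic u)
    have hpre : cdf m ⁻¹' Iic u = Iic x₀ := Subset.antisymm (fun x hx => le_csSup hbdd hx)
      fun x hx => (monotone_cdf m hx).trans hmem
    obtain ⟨y, hy⟩ := mem_range_of_exists_le_of_exists_ge hcont ⟨x₀, hmem⟩ ⟨b, hb.le⟩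
    have hx₀ : cdf m x₀ = u := le_antisymm hmem
      (hy ▸ monotone_cdf m (le_csSup hbdd (show y ∈ cdf m ⁻¹' Iic u from hy.le)))
    rw [hpre, ← ofReal_cdf, hx₀]

/-- A random variable taking the values `1` and `-1` with probability `1/2` each is a.s. `±1`. -/
theorem ae_eq_one_or_neg_one {Ω : Type*} [MeasurableSpace Ω] {μ : Measure Ω}
    [IsProbabilityMeasure μ] {η : Ω → ℝ} (hη : Measurable η)
    (hη1 : μ {ω | η ω = 1} = 1 / 2) (hη2 : μ {ω | η ω = -1} = 1 / 2) :
    ∀ᵐ ω ∂μ, η ω = 1 ∨ η ω = -1 := by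
  have hdisj : Disjoint {ω | η ω = 1} {ω | η ω = -1} :=
    Set.disjoint_left.2 fun ω (h : η ω = 1) (h' : η ω = -1) => by linarith
  have hm : MeasurableSet {ω | η ω = -1} := hη (measurableSet_singleton (-1))
  have hU : μ {ω | η ω = 1 ∨ η ω = -1} = 1 := by
    rw [ofPred_or, measure_union hdisj hm, hη1, hη2, ENNReal.add_halves]
  exact (prob_compl_eq_zero_iff ((hη (measurableSet_singleton 1)).union hm)).2 hU

/-- Conditioning on an independent sign: if `η = ±1` with probability `1/2` each, independently of
`Z`, then `Z + (1 - η) / 2` has the law of `Z` or of `Z + 1`, with probability `1/2` each. -/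
theorem measure_preimage_add_sign {Ω : Type*} [MeasurableSpace Ω] {μ : Measure Ω}
    [IsProbabilityMeasure μ] {Z η : Ω → ℝ} (hZ : Measurable Z) (hη : Measurable η)
    (hη1 : μ {ω | η ω = 1} = 1 / 2) (hη2 : μ {ω | η ω = -1} = 1 / 2) (hindep : IndepFun Z η μ)
    {s : Set ℝ} (hs : MeasurableSet s) :
    μ ((fun ω => Z ω + (1 - η ω) / 2) ⁻¹' s)
      = μ (Z ⁻¹' s) * (1 / 2) + μ (Z ⁻¹' ((· + 1) ⁻¹' s)) * (1 / 2) := by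
  have hs' : MeasurableSet ((· + (1 : ℝ)) ⁻¹' s) := measurable_add_const 1 hs
  have h1 := hindep.measure_inter_preimage_eq_mul s {1} hs (measurableSet_singleton 1)
  have h2 := hindep.measure_inter_preimage_eq_mul _ {-1} hs' (measurableSet_singleton (-1))
  change _ = μ (Z ⁻¹' s) * μ {ω | η ω = 1} at h1
  change _ = _ * μ {ω | η ω = -1} at h2
  rw [hη1] at h1
  rw [hη2] at h2
  have hae := ae_eq_one_or_neg_one hη hη1 hη2
  have hdisj : Disjoint (Z ⁻¹' s ∩ η ⁻¹' {1}) (Z ⁻¹' ((· + 1) ⁻¹' s) ∩ η ⁻¹' {-1}) :=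
    Set.disjoint_left.2 fun ω h h' => by
      have e1 : η ω = 1 := h.2
      have e2 : η ω = -1 := h'.2
      linarith
  rw [← h1, ← h2, ← measure_union hdisj ((hZ hs').inter (hη (measurableSet_singleton _)))]
  refine measure_congr ?_
  filter_upwards [hae] with ω hω
  change (Z ω + (1 - η ω) / 2 ∈ s)
    = ((Z ω ∈ s ∧ η ω = 1) ∨ (Z ω + 1 ∈ s ∧ η ω = -1))
  rcases hω with h | h <;> norm_num [h]

/-- If `Z` is standard normal, `η` is independent of `Z` with
`P(η = 1) = P(η = −1) = 1/2`, then `U = (1/2)(Φ(Z) + Φ(Z − η))` is uniformly distributed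
on `(0,1)`. Consequently, the unfocused forecast `F(y) = (1/2)(Φ(y − μ₀) + Φ(y − μ₀ − η))`
for the observation `Y = μ₀ + Z` is probabilistically calibrated: its PIT `F(Y)` is
uniformly distributed on `(0,1)`. -/
theorem stmt15
    {Ω : Type*} [MeasurableSpace Ω] (μ : Measure Ω) [IsProbabilityMeasure μ]
    (Z η : Ω → ℝ) (hZ_meas : Measurable Z) (hη_meas : Measurable η)
    (hZ_law : Measure.map Z μ = gaussianReal 0 1)
    (hη1 : μ {ω | η ω = 1} = 1 / 2) (hη2 : μ {ω | η ω = -1} = 1 / 2)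
    (hindep : IndepFun Z η μ) :
    Measure.map (fun ω => (stdNormalCDF (Z ω) + stdNormalCDF (Z ω - η ω)) / 2) μ
      = volume.restrict (Set.Ioo (0:ℝ) 1) ∧
    ∀ μ₀ : ℝ,
      Measure.map (fun ω =>
          (stdNormalCDF ((μ₀ + Z ω) - μ₀) + stdNormalCDF ((μ₀ + Z ω) - μ₀ - η ω)) / 2) μ
        = volume.restrict (Set.Ioo (0:ℝ) 1) := by
  suffices h : Measure.map (fun ω => (stdNormalCDF (Z ω) + stdNormalCDF (Z ω - η ω)) / 2) μ
      = volume.restrict (Set.Ioo (0:ℝ) 1) by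
    refine ⟨h, fun μ₀ => ?_⟩
    simpa only [add_sub_cancel_left] using h
  set W : Ω → ℝ := fun ω => Z ω + (1 - η ω) / 2 with hW
  have hW_meas : Measurable W := by fun_prop
  have hZ_apply {s : Set ℝ} (hs : MeasurableSet s) : μ (Z ⁻¹' s) = gaussianReal 0 1 s := by
    rw [← hZ_law, Measure.map_apply hZ_meas hs]
  have hW_apply {s : Set ℝ} (hs : MeasurableSet s) :
      Measure.map W μ s = gaussianReal 0 1 s * (1 / 2)
        + gaussianReal 0 1 ((· + 1) ⁻¹' s) * (1 / 2) := by
    rw [Measure.map_apply hW_meas hs,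
      measure_preimage_add_sign hZ_meas hη_meas hη1 hη2 hindep hs, hZ_apply hs,
      hZ_apply (measurable_add_const 1 hs)]
  have : IsProbabilityMeasure (Measure.map W μ) :=
    Measure.isProbabilityMeasure_map hW_meas.aemeasurable
  have : NullSingletonClass (gaussianReal 0 1) := nullSingletonClass_gaussianReal one_ne_zero
  have : NullSingletonClass (Measure.map W μ) := ⟨fun x => by
    have hpre : (· + (1 : ℝ)) ⁻¹' {x} = {x - 1} := by
      ext y; exact eq_sub_iff_add_eq.symm
    rw [hW_apply (measurableSet_singleton x), hpre]
    simp⟩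
  have hcdf (x : ℝ) : cdf (Measure.map W μ) x = (stdNormalCDF x + stdNormalCDF (x - 1)) / 2 := by
    have hpre : (· + (1 : ℝ)) ⁻¹' Iic x = Iic (x - 1) := by
      ext y; simp [le_sub_iff_add_le]
    simp only [stdNormalCDF, cdf_eq_real, measureReal_def]
    rw [hW_apply measurableSet_Iic, hpre, ENNReal.toReal_add (by finiteness) (by finiteness)]
    simp only [ENNReal.toReal_mul, one_div, ENNReal.toReal_inv, ENNReal.toReal_ofNat]
    ring
  rw [← map_cdf_eq_uniform (Measure.map W μ), Measure.map_map (cdf _).mono.measurable hW_meas]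
  refine Measure.map_congr ?_
  filter_upwards [ae_eq_one_or_neg_one hη_meas hη1 hη2] with ω hω
  rw [Function.comp_apply, hcdf, hW]
  rcases hω with h | h <;> norm_num [h, add_comm]
end
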